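/- There exists a constant C > 0 with the following property: for every real 2×2 matrix A with det A = 1, every real L ≥ 1, and every nonzero v₀ ∈ ℤ² such that ‖A·v₀‖ ≤ ‖A·v‖ for all nonzero v ∈ ℤ² (i.e. v₀ realizes the shortest nonzero vector of the lattice A·ℤ²), the number of pairs (m,n) ∈ ℤ × ℤ with gcd(m,n) = 1 and ‖A·(m,n)‖ ≤ L is at most C · L² / ‖A·v₀‖. -/

import Mathlib

/-- The Euclidean norm of the image of the integer vector `v ∈ ℤ²` under the linear map
given by the real matrix `A`. -/
noncomputable def latticeImageNorm (A : Matrix (Fin 2) (Fin 2) ℝ) (v : ℤ × ℤ) : ℝ :=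
  Real.sqrt ((A 0 0 * (v.1 : ℝ) + A 0 1 * (v.2 : ℝ)) ^ 2
    + (A 1 0 * (v.1 : ℝ) + A 1 1 * (v.2 : ℝ)) ^ 2)

/-- The inner product of the images of `v` and `w` under `A`. -/
noncomputable def latticeImageInner (A : Matrix (Fin 2) (Fin 2) ℝ) (v w : ℤ × ℤ) : ℝ :=
  (A 0 0 * (v.1 : ℝ) + A 0 1 * (v.2 : ℝ)) * (A 0 0 * (w.1 : ℝ) + A 0 1 * (w.2 : ℝ))
    + (A 1 0 * (v.1 : ℝ) + A 1 1 * (v.2 : ℝ)) * (A 1 0 * (w.1 : ℝ) + A 1 1 * (w.2 : ℝ))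

/-- The determinant of the pair of integer vectors `v`, `w`. -/
def intCross (v w : ℤ × ℤ) : ℤ := v.1 * w.2 - v.2 * w.1

section

variable {A : Matrix (Fin 2) (Fin 2) ℝ}

theorem latticeImageNorm_nonneg (v : ℤ × ℤ) : 0 ≤ latticeImageNorm A v := Real.sqrt_nonneg _

theorem latticeImageNorm_sq (v : ℤ × ℤ) :
    latticeImageNorm A v ^ 2 = latticeImageInner A v v := by
  rw [latticeImageNorm, Real.sq_sqrt (by positivity), latticeImageInner]
  ring

theorem latticeImageInner_sub_right (v w x : ℤ × ℤ) :
    latticeImageInner A v (w - x) = latticeImageInner A v w - latticeImageInner A v x := by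
  simp only [latticeImageInner, Prod.fst_sub, Prod.snd_sub]
  push_cast
  ring

theorem latticeImageInner_smul_right (v w : ℤ × ℤ) (k : ℤ) :
    latticeImageInner A v (k • w) = k * latticeImageInner A v w := by
  simp only [latticeImageInner, Prod.smul_fst, Prod.smul_snd, smul_eq_mul]
  push_cast
  ring

theorem latticeImageNorm_smul (v : ℤ × ℤ) (k : ℤ) :
    latticeImageNorm A (k • v) = |(k : ℝ)| * latticeImageNorm A v := by
  rw [← sq_eq_sq₀ (latticeImageNorm_nonneg _)
    (mul_nonneg (abs_nonneg _) (latticeImageNorm_nonneg _)), mul_pow, sq_abs,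
    latticeImageNorm_sq, latticeImageNorm_sq]
  simp only [latticeImageInner, Prod.smul_fst, Prod.smul_snd, smul_eq_mul]
  push_cast
  ring

theorem latticeImageNorm_mul_sq (hA : A.det = 1) (v w : ℤ × ℤ) :
    latticeImageNorm A v ^ 2 * latticeImageNorm A w ^ 2
      = latticeImageInner A v w ^ 2 + (intCross v w : ℝ) ^ 2 := by
  rw [Matrix.det_fin_two] at hA
  have h : (intCross v w : ℝ) = (A 0 0 * A 1 1 - A 0 1 * A 1 0) * intCross v w := by
    rw [hA, one_mul]
  rw [h, latticeImageNorm_sq, latticeImageNorm_sq]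
  simp only [latticeImageInner, intCross]
  push_cast
  ring

theorem abs_latticeImageInner_le (hA : A.det = 1) (v w : ℤ × ℤ) :
    |latticeImageInner A v w| ≤ latticeImageNorm A v * latticeImageNorm A w := by
  refine abs_le_of_sq_le_sq ?_
    (mul_nonneg (latticeImageNorm_nonneg _) (latticeImageNorm_nonneg _))
  nlinarith [latticeImageNorm_mul_sq hA v w, sq_nonneg (intCross v w : ℝ)]

theorem abs_intCross_le (hA : A.det = 1) (v w : ℤ × ℤ) :
    |(intCross v w : ℝ)| ≤ latticeImageNorm A v * latticeImageNorm A w := by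
  refine abs_le_of_sq_le_sq ?_
    (mul_nonneg (latticeImageNorm_nonneg _) (latticeImageNorm_nonneg _))
  nlinarith [latticeImageNorm_mul_sq hA v w, sq_nonneg (latticeImageInner A v w)]

theorem latticeImageNorm_pos (hA : A.det = 1) {v : ℤ × ℤ} (hv : v ≠ 0) :
    0 < latticeImageNorm A v := by
  refine lt_of_le_of_ne (latticeImageNorm_nonneg _) fun h => hv ?_
  have h1 := abs_intCross_le hA v (1, 0)
  have h2 := abs_intCross_le hA v (0, 1)
  rw [← h, zero_mul, abs_nonpos_iff, Int.cast_eq_zero] at h1 h2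
  simp only [intCross] at h1 h2
  ext <;> simp <;> linarith

theorem ne_zero_of_gcd_eq_one {v : ℤ × ℤ} (h : Int.gcd v.1 v.2 = 1) : v ≠ 0 := by
  rintro rfl
  simp at h

variable {v₀ : ℤ × ℤ}

/-- Only `±1` times a nonzero vector can equal a shortest vector. -/
theorem eq_one_or_neg_one_of_smul_eq_shortest (hA : A.det = 1) (h₀ : v₀ ≠ 0)
    (hmin : ∀ v : ℤ × ℤ, v ≠ 0 → latticeImageNorm A v₀ ≤ latticeImageNorm A v)
    {k : ℤ} {v : ℤ × ℤ} (h : v₀ = k • v) : k = 1 ∨ k = -1 := by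
  have hv : v ≠ 0 := by rintro rfl; simp [h₀] at h
  have hk : k ≠ 0 := by rintro rfl; simp [h₀] at h
  have hle := hmin v hv
  rw [h, latticeImageNorm_smul] at hle
  have hpos := latticeImageNorm_pos hA hv
  have h1 : |(k : ℝ)| ≤ 1 := by
    by_contra! h2
    nlinarith
  have h2 : |k| ≤ 1 := by exact_mod_cast h1
  rw [abs_le] at h2
  omega

/-- The shortest vector of a unimodular lattice in the plane has norm at most `2`. -/
theorem latticeImageNorm_shortest_le_two (hA : A.det = 1) (h₀ : v₀ ≠ 0)
    (hmin : ∀ v : ℤ × ℤ, v ≠ 0 → latticeImageNorm A v₀ ≤ latticeImageNorm A v) :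
    latticeImageNorm A v₀ ≤ 2 := by
  have hpos := latticeImageNorm_pos hA h₀
  set s := latticeImageNorm A v₀ with hs
  have hg : Int.gcd v₀.1 v₀.2 = 1 := by
    obtain ⟨x, hx⟩ := Int.gcd_dvd_left v₀.1 v₀.2
    obtain ⟨y, hy⟩ := Int.gcd_dvd_right v₀.1 v₀.2
    have h : v₀ = ((Int.gcd v₀.1 v₀.2 : ℕ) : ℤ) • ((x, y) : ℤ × ℤ) := Prod.ext hx hy
    have := eq_one_or_neg_one_of_smul_eq_shortest hA h₀ hmin h
    omega
  have hbez := Int.gcd_eq_gcd_ab v₀.1 v₀.2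
  rw [hg] at hbez
  set w : ℤ × ℤ := (-Int.gcdB v₀.1 v₀.2, Int.gcdA v₀.1 v₀.2) with hw
  set k := round (latticeImageInner A v₀ w / s ^ 2)
  have hcross : intCross v₀ (w - k • v₀) = 1 := by
    simp only [intCross, hw, Prod.fst_sub, Prod.snd_sub, Prod.smul_fst, Prod.smul_snd, smul_eq_mul]
    push_cast at hbez
    linear_combination -hbez
  have hne : w - k • v₀ ≠ 0 := by
    intro h
    rw [h] at hcross
    simp [intCross] at hcross
  have hinner : |latticeImageInner A v₀ (w - k • v₀)| ≤ s ^ 2 / 2 := by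
    have h := abs_sub_round (latticeImageInner A v₀ w / s ^ 2)
    have h2 : latticeImageInner A v₀ (w - k • v₀)
        = s ^ 2 * (latticeImageInner A v₀ w / s ^ 2 - k) := by
      rw [latticeImageInner_sub_right, latticeImageInner_smul_right, ← latticeImageNorm_sq, ← hs]
      field_simp
    rw [h2, abs_mul, abs_of_pos (by positivity : 0 < s ^ 2)]
    nlinarith [sq_pos_of_pos hpos]
  have hmul := latticeImageNorm_mul_sq hA v₀ (w - k • v₀)
  rw [hcross, ← hs] at hmul
  have hle : s ^ 2 ≤ latticeImageNorm A (w - k • v₀) ^ 2 :=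
    pow_le_pow_left₀ hpos.le (hmin _ hne) 2
  have hsq : latticeImageInner A v₀ (w - k • v₀) ^ 2 ≤ (s ^ 2 / 2) ^ 2 :=
    sq_le_sq' (abs_le.1 hinner).1 (abs_le.1 hinner).2
  push_cast at hmul
  by_contra! h
  have h4 : 4 < s ^ 2 := by nlinarith
  nlinarith [mul_le_mul_of_nonneg_left hle (sq_nonneg s)]

/-- A primitive vector parallel to a shortest vector is that vector up to sign. -/
theorem eq_or_eq_neg_of_intCross_eq_zero (hA : A.det = 1) (h₀ : v₀ ≠ 0)
    (hmin : ∀ v : ℤ × ℤ, v ≠ 0 → latticeImageNorm A v₀ ≤ latticeImageNorm A v)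
    {v : ℤ × ℤ} (hv : Int.gcd v.1 v.2 = 1) (h : intCross v₀ v = 0) : v = v₀ ∨ v = -v₀ := by
  have hbez := Int.gcd_eq_gcd_ab v.1 v.2
  rw [hv] at hbez
  push_cast at hbez
  simp only [intCross] at h
  have hk : v₀ = (v₀.1 * Int.gcdA v.1 v.2 + v₀.2 * Int.gcdB v.1 v.2) • v := by
    ext
    · simp only [Prod.smul_fst, smul_eq_mul]
      linear_combination v₀.1 * hbez + Int.gcdB v.1 v.2 * h
    · simp only [Prod.smul_snd, smul_eq_mul]
      linear_combination v₀.2 * hbez - Int.gcdA v.1 v.2 * h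
  rcases eq_one_or_neg_one_of_smul_eq_shortest hA h₀ hmin hk with h1 | h1 <;> rw [h1] at hk
  · left; simpa using hk.symm
  · right; rw [hk]; simp

/-- A vector is determined by its determinant with a shortest vector `v₀` and the integer part of
its coordinate along `v₀`. -/
theorem injective_intCross_floor (hA : A.det = 1) (h₀ : v₀ ≠ 0)
    (hmin : ∀ v : ℤ × ℤ, v ≠ 0 → latticeImageNorm A v₀ ≤ latticeImageNorm A v) :
    Function.Injective fun v : ℤ × ℤ =>
      (intCross v₀ v, ⌊latticeImageInner A v₀ v / latticeImageNorm A v₀ ^ 2⌋) := by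
  intro v w h
  obtain ⟨h1, h2⟩ := Prod.mk.inj h
  have hpos := latticeImageNorm_pos hA h₀
  have hcross : intCross v₀ (v - w) = 0 := by
    simp only [intCross, Prod.fst_sub, Prod.snd_sub] at h1 ⊢
    linear_combination h1
  by_contra hne
  have hle := pow_le_pow_left₀ hpos.le (hmin (v - w) (sub_ne_zero.2 hne)) 2
  have hmul := latticeImageNorm_mul_sq hA v₀ (v - w)
  have hlt := Int.abs_sub_lt_one_of_floor_eq_floor h2
  rw [← sub_div, ← latticeImageInner_sub_right, abs_div,
    abs_of_pos (by positivity : 0 < latticeImageNorm A v₀ ^ 2), div_lt_one (by positivity)] at hlt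
  rw [hcross, ← sq_abs (latticeImageInner _ _ _)] at hmul
  push_cast at hmul
  nlinarith [mul_le_mul_of_nonneg_left hle (sq_nonneg (latticeImageNorm A v₀)),
    pow_lt_pow_left₀ hlt (abs_nonneg _) two_ne_zero]

end

/-- **Uniform integrability bound for primitive lattice point counts.** There is a constant
`C > 0` such that for every `A ∈ SL(2,ℝ)`, every `L ≥ 1`, and every nonzero `v₀ ∈ ℤ²`
realizing the shortest nonzero vector of the lattice `A·ℤ²`, the number of primitive integer
vectors `v` with `‖A·v‖ ≤ L` is at most `C · L² / ‖A·v₀‖`. -/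
theorem primitive_count_le_of_shortest_vector :
    ∃ C : ℝ, 0 < C ∧ ∀ A : Matrix (Fin 2) (Fin 2) ℝ, A.det = 1 →
      ∀ L : ℝ, 1 ≤ L → ∀ v₀ : ℤ × ℤ, v₀ ≠ 0 →
      (∀ v : ℤ × ℤ, v ≠ 0 → latticeImageNorm A v₀ ≤ latticeImageNorm A v) →
      (Nat.card {v : ℤ × ℤ // Int.gcd v.1 v.2 = 1 ∧ latticeImageNorm A v ≤ L} : ℝ)
        ≤ C * L ^ 2 / latticeImageNorm A v₀ := by
  refine ⟨24, by norm_num, fun A hA L hL v₀ h₀ hmin => ?_⟩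
  have hpos := latticeImageNorm_pos hA h₀
  have hs2 := latticeImageNorm_shortest_le_two hA h₀ hmin
  set s := latticeImageNorm A v₀ with hs
  rw [le_div_iff₀ hpos]
  suffices h : (Nat.card {v : ℤ × ℤ // Int.gcd v.1 v.2 = 1 ∧ latticeImageNorm A v ≤ L} : ℝ)
      ≤ 12 * L ^ 2 by nlinarith [sq_nonneg L]
  change (Nat.card ({v | Int.gcd v.1 v.2 = 1 ∧ latticeImageNorm A v ≤ L} : Set (ℤ × ℤ)) : ℝ) ≤ _
  rw [Nat.card_coe_set_eq]
  rcases lt_or_ge L s with hLs | hLs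
  · have : {v : ℤ × ℤ | Int.gcd v.1 v.2 = 1 ∧ latticeImageNorm A v ≤ L} = ∅ := by
      refine Set.eq_empty_of_forall_notMem fun v ⟨hv, hvL⟩ => ?_
      linarith [hmin v (ne_zero_of_gcd_eq_one hv)]
    rw [this, Set.ncard_empty]
    push_cast
    positivity
  have hcross {v : ℤ × ℤ} (hv : latticeImageNorm A v ≤ L) : |(intCross v₀ v : ℝ)| ≤ s * L :=
    (abs_intCross_le hA v₀ v).trans (mul_le_mul_of_nonneg_left hv hpos.le)
  rcases lt_or_ge (s * L) 1 with hsL | hsL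
  · have hsub : {v : ℤ × ℤ | Int.gcd v.1 v.2 = 1 ∧ latticeImageNorm A v ≤ L} ⊆ {v₀, -v₀} := by
      rintro v ⟨hv, hvL⟩
      refine eq_or_eq_neg_of_intCross_eq_zero hA h₀ hmin hv (Int.abs_lt_one_iff.1 ?_)
      exact_mod_cast (hcross hvL).trans_lt hsL
    have hcard := (Set.ncard_le_ncard hsub).trans (Set.ncard_insert_le _ _)
    rw [Set.ncard_singleton] at hcard
    have : (Set.ncard {v : ℤ × ℤ | Int.gcd v.1 v.2 = 1 ∧ latticeImageNorm A v ≤ L} : ℝ) ≤ 2 := by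
      exact_mod_cast hcard
    nlinarith
  · set T : Finset (ℤ × ℤ) := Finset.Icc (-⌊s * L⌋) ⌊s * L⌋ ×ˢ Finset.Icc (-⌊L / s⌋ - 1) ⌊L / s⌋
      with hT
    have hcard : Set.ncard {v : ℤ × ℤ | Int.gcd v.1 v.2 = 1 ∧ latticeImageNorm A v ≤ L}
        ≤ T.card := by
      rw [← Set.ncard_coe_finset]
      refine Set.ncard_le_ncard_of_injOn _ ?_ (injective_intCross_floor hA h₀ hmin).injOn
      rintro v ⟨-, hvL⟩
      have hc := abs_le.1 (hcross hvL)
      have hi : |latticeImageInner A v₀ v / s ^ 2| ≤ L / s := by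
        rw [abs_div, abs_of_pos (by positivity : 0 < s ^ 2), div_le_div_iff₀ (by positivity) hpos]
        nlinarith [(abs_latticeImageInner_le hA v₀ v).trans
          (mul_le_mul_of_nonneg_left hvL hpos.le)]
      have hi' := abs_le.1 hi
      simp only [hT, Finset.coe_product, Finset.coe_Icc, Set.mem_prod, Set.mem_Icc]
      refine ⟨⟨neg_le.1 (Int.le_floor.2 ?_), Int.le_floor.2 hc.2⟩, Int.le_floor.2 ?_,
        Int.floor_le_floor hi'.2⟩
      · push_cast
        linarith
      · push_cast
        linarith [Int.lt_floor_add_one (L / s)]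
    have hLs' : 1 ≤ L / s := (one_le_div hpos).2 hLs
    have hf1 : 0 ≤ ⌊s * L⌋ := Int.floor_nonneg.2 (by linarith)
    have hf2 : 0 ≤ ⌊L / s⌋ := Int.floor_nonneg.2 (by linarith)
    have hTcard : (T.card : ℤ) = (2 * ⌊s * L⌋ + 1) * (2 * ⌊L / s⌋ + 2) := by
      rw [hT, Finset.card_product, Int.card_Icc, Int.card_Icc]
      push_cast
      rw [Int.toNat_of_nonneg (by linarith), Int.toNat_of_nonneg (by linarith)]
      ring
    have hf1' : (0 : ℝ) ≤ ⌊s * L⌋ := by exact_mod_cast hf1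
    have hf2' : (0 : ℝ) ≤ ⌊L / s⌋ := by exact_mod_cast hf2
    calc (Set.ncard {v : ℤ × ℤ | Int.gcd v.1 v.2 = 1 ∧ latticeImageNorm A v ≤ L} : ℝ)
        ≤ T.card := by exact_mod_cast hcard
      _ = (2 * ⌊s * L⌋ + 1) * (2 * ⌊L / s⌋ + 2) := by exact_mod_cast hTcard
      _ ≤ (3 * (s * L)) * (4 * (L / s)) := by
          refine mul_le_mul ?_ ?_ (by positivity) (by positivity)
          · linarith [Int.floor_le (s * L)]
          · linarith [Int.floor_le (L / s)]
      _ = 12 * L ^ 2 := by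
          field_simp
          ring
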